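/- For every (r,θ) ∈ [−1,1]² with (r,θ) ≠ (0,0), the partial derivatives of ψ_α satisfy |∂_r ψ_α(r,θ)| ≤ (11 + 10/α)·|θ| and |∂_θ ψ_α(r,θ)| ≤ (11 + 10/α)·|r|. Moreover, there exists a constant C = C(α) > 0, depending only on α, such that at all such points |∂_r ψ_α(r,θ)| ≤ C·|r|^α and |∂_θ ψ_α(r,θ)| ≤ C·|θ|^α. -/

import Mathlib

/-- The bump function hypotheses: `b` is smooth, `b = 0` on `(−∞, 1/2]`,
`b = 1` on `[1, ∞)`, `0 ≤ b ≤ 1`, `|b'| ≤ 10`, `|b''| ≤ 100`. -/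
def GoodBump (b : ℝ → ℝ) : Prop :=
  ContDiff ℝ (⊤ : ℕ∞) b ∧ (∀ x : ℝ, x ≤ 1 / 2 → b x = 0) ∧
    (∀ x : ℝ, 1 ≤ x → b x = 1) ∧ (∀ x : ℝ, 0 ≤ b x ∧ b x ≤ 1) ∧
    (∀ x : ℝ, |deriv b x| ≤ 10) ∧ (∀ x : ℝ, |deriv (deriv b) x| ≤ 100)

/-- The function `ψ_α(r,θ) = |rθ|·b(|θ|/|r|^{1/α})·b(|r|/|θ|^{1/α})` for `rθ ≠ 0`,
and `ψ_α(r,θ) = 0` for `rθ = 0`.  Here `|x| ^ (1/α)` is the real power. -/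
noncomputable def psiAlpha (α : ℝ) (b : ℝ → ℝ) (r θ : ℝ) : ℝ :=
  if r * θ = 0 then 0
  else |r * θ| * b (|θ| / |r| ^ (1 / α)) * b (|r| / |θ| ^ (1 / α))

theorem psiAlpha_eq (α : ℝ) (b : ℝ → ℝ) (r θ : ℝ) :
    psiAlpha α b r θ =
      |r| * |θ| * b (|θ| / |r| ^ (1 / α)) * b (|r| / |θ| ^ (1 / α)) := by
  unfold psiAlpha
  split_ifs with h
  · rw [← abs_mul, h]; simp
  · rw [abs_mul]

theorem psiAlpha_comm (α : ℝ) (b : ℝ → ℝ) (r θ : ℝ) :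
    psiAlpha α b r θ = psiAlpha α b θ r := by
  rw [psiAlpha_eq, psiAlpha_eq]; ring

theorem GoodBump.abs_mul_deriv_le {b : ℝ → ℝ} (hb : GoodBump b) {x : ℝ} (hx : 0 ≤ x) :
    |x * deriv b x| ≤ 10 := by
  obtain ⟨-, -, h1, -, hd, -⟩ := hb
  rcases le_or_gt x 1 with h | h
  · rw [abs_mul, abs_of_nonneg hx]
    nlinarith [hd x, abs_nonneg (deriv b x)]
  · have hev : b =ᶠ[nhds x] fun _ => (1 : ℝ) := by
      filter_upwards [lt_mem_nhds h] with y hy using h1 y hy.le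
    rw [hev.deriv_eq]
    simp

/-- Outside the support of the second cutoff, `ψ_α` is locally zero in its first variable. -/
theorem deriv_psiAlpha_eq_zero {α : ℝ} {b : ℝ → ℝ} (hb : GoodBump b) {r θ : ℝ}
    (h : |r| / |θ| ^ (1 / α) < 1 / 2) :
    deriv (fun s => psiAlpha α b s θ) r = 0 := by
  have hc : Continuous fun s : ℝ => |s| / |θ| ^ (1 / α) := by fun_prop
  have hev : (fun s => psiAlpha α b s θ) =ᶠ[nhds r] fun _ => (0 : ℝ) := by
    filter_upwards [hc.continuousAt.eventually_lt_const h] with s hs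
    rw [psiAlpha_eq, hb.2.1 _ hs.le, mul_zero]
  rw [hev.deriv_eq]
  simp

theorem abs_deriv_psiAlpha_le {α : ℝ} (hα : 0 < α) {b : ℝ → ℝ} (hb : GoodBump b) {r θ : ℝ}
    (hr : r ≠ 0) (hθ : θ ≠ 0) :
    |deriv (fun s => psiAlpha α b s θ) r| ≤ (11 + 10 / α) * |θ| := by
  have hbd : Differentiable ℝ b := hb.1.differentiable (by simp)
  have ht : 0 < |r| := abs_pos.mpr hr
  have hm : 0 < |θ| := abs_pos.mpr hθ
  set t := |r|
  set m := |θ|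
  set p := 1 / α with hp
  have hp0 : 0 < p := by positivity
  set u := m / t ^ p with hu
  set v := t / m ^ p with hv
  have htp : 0 < t ^ p := by positivity
  have hmp : 0 < m ^ p := by positivity
  have hu0 : 0 ≤ u := by positivity
  have hv0 : 0 ≤ v := by positivity
  have hU : HasDerivAt (fun x : ℝ => m / x ^ p) (-(p * u / t)) t := by
    have h1 := (hasDerivAt_const t m).div (Real.hasDerivAt_rpow_const (p := p) (Or.inl ht.ne'))
      htp.ne'
    refine h1.congr_deriv ?_
    rw [Real.rpow_sub_one ht.ne', hu]
    field_simp
    ring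
  have hV : HasDerivAt (fun x : ℝ => x / m ^ p) (1 / m ^ p) t := (hasDerivAt_id t).div_const _
  have hbU : HasDerivAt (fun x : ℝ => b (m / x ^ p)) (deriv b u * -(p * u / t)) t :=
    (hbd u).hasDerivAt.comp t hU
  have hbV : HasDerivAt (fun x : ℝ => b (x / m ^ p)) (deriv b v * (1 / m ^ p)) t :=
    (hbd v).hasDerivAt.comp t hV
  have hg : HasDerivAt (fun x : ℝ => x * m * b (m / x ^ p) * b (x / m ^ p))
      (m * (b u * b v - p * (u * deriv b u) * b v + b u * (v * deriv b v))) t := by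
    have h1 := (((hasDerivAt_id t).mul_const m).mul hbU).mul hbV
    refine h1.congr_deriv ?_
    simp only [id, Pi.mul_apply, ← hu, ← hv]
    rw [show v * deriv b v = t / m ^ p * deriv b v from rfl]
    field_simp
    ring
  have hpsi : HasDerivAt (fun s => psiAlpha α b s θ)
      (m * (b u * b v - p * (u * deriv b u) * b v + b u * (v * deriv b v)) *
        (SignType.sign r : ℝ)) r := by
    have h1 := HasDerivAt.comp r hg (hasDerivAt_abs hr)
    exact h1.congr_of_eventuallyEq (.of_forall fun s => psiAlpha_eq α b s θ)
  have hsign : |((SignType.sign r : SignType) : ℝ)| = 1 := by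
    rcases lt_or_gt_of_ne hr with h | h <;> simp [h]
  rw [hpsi.deriv, abs_mul, hsign, mul_one, abs_mul, abs_of_pos hm, mul_comm]
  gcongr
  have hbu := hb.2.2.2.1 u
  have hbv := hb.2.2.2.1 v
  have hbu' : |b u| ≤ 1 := abs_le.mpr ⟨by linarith, hbu.2⟩
  have hbv' : |b v| ≤ 1 := abs_le.mpr ⟨by linarith, hbv.2⟩
  have hdu := hb.abs_mul_deriv_le hu0
  have hdv := hb.abs_mul_deriv_le hv0
  calc _ ≤ |b u * b v| + |p * (u * deriv b u) * b v| + |b u * (v * deriv b v)| :=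
        (abs_add_le _ _).trans (by gcongr; exact abs_sub _ _)
    _ = |b u| * |b v| + p * |u * deriv b u| * |b v| + |b u| * |v * deriv b v| := by
        simp only [abs_mul, abs_of_pos hp0]
    _ ≤ 1 * 1 + p * 10 * 1 + 1 * 10 := by gcongr
    _ = 11 + 10 / α := by rw [hp]; ring

theorem abs_deriv_psiAlpha_bounds {α : ℝ} (hα0 : 0 < α) (hα1 : α < 1)
    {b : ℝ → ℝ} (hb : GoodBump b) (r θ : ℝ) :
    |deriv (fun s => psiAlpha α b s θ) r| ≤ (11 + 10 / α) * |θ| ∧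
      |deriv (fun s => psiAlpha α b s θ) r| ≤ 2 * (11 + 10 / α) * |r| ^ α := by
  rcases lt_or_ge (|r| / |θ| ^ (1 / α)) (1 / 2) with h | h
  · rw [deriv_psiAlpha_eq_zero hb h, abs_zero]
    constructor <;> positivity
  have hθ : θ ≠ 0 := by
    rintro rfl
    rw [abs_zero, Real.zero_rpow (by positivity)] at h
    norm_num at h
  have hr : r ≠ 0 := by
    rintro rfl
    norm_num at h
  have hm : 0 < |θ| := abs_pos.mpr hθ
  have hle := abs_deriv_psiAlpha_le hα0 hb hr hθ
  refine ⟨hle, hle.trans ?_⟩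
  rw [le_div_iff₀ (by positivity)] at h
  have h2 : |θ| ≤ 2 * |r| ^ α :=
    calc |θ| = (|θ| ^ (1 / α)) ^ α := by
          rw [← Real.rpow_mul hm.le, one_div_mul_cancel hα0.ne', Real.rpow_one]
      _ ≤ (2 * |r|) ^ α := by gcongr; linarith
      _ = 2 ^ α * |r| ^ α := Real.mul_rpow (by norm_num) (abs_nonneg r)
      _ ≤ 2 * |r| ^ α := by
          gcongr
          exact Real.rpow_le_self_of_one_le (by norm_num) hα1.le
  calc _ ≤ (11 + 10 / α) * (2 * |r| ^ α) := by gcongr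
    _ = _ := by ring

/-- First-derivative estimates for `ψ_α`: for `(r,θ) ∈ [−1,1]²`,
`(r,θ) ≠ (0,0)`, one has `|∂_r ψ_α| ≤ (11 + 10/α)·|θ|` and
`|∂_θ ψ_α| ≤ (11 + 10/α)·|r|`; moreover there is `C = C(α) > 0` with
`|∂_r ψ_α| ≤ C·|r|^α` and `|∂_θ ψ_α| ≤ C·|θ|^α` at all such points. -/
theorem psiAlpha_first_derivative_bounds (α : ℝ) (hα0 : 0 < α) (hα1 : α < 1)
    (b : ℝ → ℝ) (hb : GoodBump b) :
    (∀ r θ : ℝ, r ∈ Set.Icc (-1 : ℝ) 1 → θ ∈ Set.Icc (-1 : ℝ) 1 →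
      (r, θ) ≠ ((0 : ℝ), (0 : ℝ)) →
      |deriv (fun s => psiAlpha α b s θ) r| ≤ (11 + 10 / α) * |θ| ∧
      |deriv (fun s => psiAlpha α b r s) θ| ≤ (11 + 10 / α) * |r|) ∧
    ∃ C : ℝ, 0 < C ∧
      ∀ r θ : ℝ, r ∈ Set.Icc (-1 : ℝ) 1 → θ ∈ Set.Icc (-1 : ℝ) 1 →
        (r, θ) ≠ ((0 : ℝ), (0 : ℝ)) →
        |deriv (fun s => psiAlpha α b s θ) r| ≤ C * |r| ^ α ∧
        |deriv (fun s => psiAlpha α b r s) θ| ≤ C * |θ| ^ α := by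
  have key := abs_deriv_psiAlpha_bounds hα0 hα1 hb
  have key' (r θ : ℝ) : |deriv (fun s => psiAlpha α b r s) θ| ≤ (11 + 10 / α) * |r| ∧
      |deriv (fun s => psiAlpha α b r s) θ| ≤ 2 * (11 + 10 / α) * |θ| ^ α := by
    rw [funext (psiAlpha_comm α b r)]
    exact key θ r
  exact ⟨fun r θ _ _ _ => ⟨(key r θ).1, (key' r θ).1⟩, 2 * (11 + 10 / α), by positivity,
    fun r θ _ _ _ => ⟨(key r θ).2, (key' r θ).2⟩⟩
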